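/- Let φ* denote the unitary Euler function: the multiplicative function with φ*(p^ν) = p^ν − 1 for every prime power p^ν. Then liminf_{n→∞} φ*(n)·log log n / n = e^{-γ}. -/

import Mathlib

open Filter Real
open scoped Topology Nat

theorem log_factorial_eq_sum_primesLE (n : ℕ) :
    log (n ! : ℝ) = ∑ p ∈ Nat.primesLE n, (padicValNat p n ! : ℝ) * log p := by
  rw [Real.log_nat_eq_sum_factorization, Finsupp.sum_of_support_subset (s := Nat.primesLE n)]
  · refine Finset.sum_congr rfl fun p hp => ?_
    rw [Nat.factorization_def _ (Nat.prime_of_mem_primesLE hp)]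
  · intro p hp
    rw [Nat.support_factorization, Nat.mem_primeFactors] at hp
    rw [Nat.mem_primesLE]
    exact ⟨(hp.1.dvd_factorial).1 hp.2.1, hp.1⟩
  · simp

theorem div_le_padicValNat_factorial {p n : ℕ} (hp : p.Prime) :
    n / p ≤ padicValNat p n ! := by
  have := Fact.mk hp
  rw [← padicValNat_dvd_iff_le (Nat.factorial_ne_zero n)]
  refine Dvd.dvd.trans ?_ (Nat.factorial_dvd_factorial (Nat.mul_div_le n p))
  rw [padicValNat_dvd_iff_le (Nat.factorial_ne_zero _), padicValNat_factorial_mul]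
  exact Nat.le_add_left _ _

theorem padicValNat_factorial_le_div_sub_one {p n : ℕ} (hp : p.Prime) :
    (padicValNat p n ! : ℝ) ≤ n / (p - 1) := by
  have := Fact.mk hp
  have h := sub_one_mul_padicValNat_factorial (p := p) n
  have h1 : (p - 1) * padicValNat p n ! ≤ n := by omega
  have h2 : (1 : ℝ) < p := by exact_mod_cast hp.one_lt
  rw [le_div_iff₀ (by linarith)]
  have h3 : (((p - 1) * padicValNat p n ! : ℕ) : ℝ) ≤ n := by exact_mod_cast h1
  rw [Nat.cast_mul, Nat.cast_sub hp.one_lt.le] at h3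
  push_cast at h3
  linarith

theorem summable_log_div_mul_sub_one :
    Summable fun n : ℕ => log n / (n * (n - 1) : ℝ) := by
  have h : Summable fun n : ℕ => 4 * (1 / (n : ℝ) ^ (3 / 2 : ℝ)) :=
    (Real.summable_one_div_nat_rpow.2 (by norm_num)).mul_left 4
  refine Summable.of_nonneg_of_le (fun n => ?_) (fun n => ?_) h
  · rcases n with _ | n
    · simp
    · push_cast
      have := log_nonneg (show (1 : ℝ) ≤ n + 1 by linarith [n.cast_nonneg (α := ℝ)])
      rw [add_sub_cancel_right]
      positivity
  · rcases n with _ | _ | n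
    · simp
    · simp
    · set x : ℝ := ((n + 1 + 1 : ℕ) : ℝ) with hx
      have hx2 : 2 ≤ x := by rw [hx]; push_cast; linarith [n.cast_nonneg (α := ℝ)]
      have h1 : log x ≤ 2 * x ^ (1 / 2 : ℝ) := by
        have := Real.log_le_rpow_div (show 0 ≤ x by linarith) (show (0 : ℝ) < 1 / 2 by norm_num)
        linarith
      have h2 : x ^ (3 / 2 : ℝ) * x ^ (1 / 2 : ℝ) = x ^ 2 := by
        rw [← rpow_add (by linarith)]; norm_num
      have h3 : 0 < x ^ (3 / 2 : ℝ) := rpow_pos_of_pos (by linarith) _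
      rw [mul_one_div, div_le_div_iff₀ (by nlinarith) h3]
      nlinarith [mul_le_mul_of_nonneg_left h1 h3.le]

theorem exists_abs_sum_log_div_sub_log_le :
    ∃ C, ∀ n : ℕ, |∑ p ∈ Nat.primesLE n, log p / p - log n| ≤ C := by
  set S := ∑' n : ℕ, log n / (n * (n - 1) : ℝ) with hS
  have hS0 : ∀ n : ℕ, 0 ≤ log n / (n * (n - 1) : ℝ) := fun n => by
    rcases n with _ | n
    · simp
    · push_cast
      have := log_nonneg (show (1 : ℝ) ≤ n + 1 by linarith [n.cast_nonneg (α := ℝ)])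
      rw [add_sub_cancel_right]
      positivity
  have hSpos : 0 ≤ S := tsum_nonneg hS0
  refine ⟨1 + S + log 4, fun n => ?_⟩
  rcases Nat.eq_zero_or_pos n with rfl | hn
  · have : Nat.primesLE 0 = ∅ := by decide
    have := log_nonneg (show (1 : ℝ) ≤ 4 by norm_num)
    simp [*]
    linarith
  have hn' : (0 : ℝ) < n := by exact_mod_cast hn
  have hn1 : (1 : ℝ) ≤ n := by exact_mod_cast hn
  have hfac := log_factorial_eq_sum_primesLE n
  have hup : log (n ! : ℝ) ≤ n * log n := by
    rw [← log_pow]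
    exact log_le_log (by positivity) (by exact_mod_cast Nat.factorial_le_pow n)
  have hlow : n * log n - n ≤ log (n ! : ℝ) := by
    have := Stirling.le_log_factorial_stirling hn.ne'
    have h1 := log_nonneg hn1
    have h2 := log_nonneg (show 1 ≤ 2 * π by linarith [pi_gt_three])
    linarith
  have hA : n * ∑ p ∈ Nat.primesLE n, log p / p - Chebyshev.theta n ≤ log (n ! : ℝ) := by
    rw [hfac, Chebyshev.theta_eq_sum_primesLE_log, Finset.mul_sum, ← Finset.sum_sub_distrib]
    refine Finset.sum_le_sum fun p hp => ?_
    have hpp := Nat.prime_of_mem_primesLE hp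
    have hl := log_nonneg (show (1 : ℝ) ≤ p by exact_mod_cast hpp.one_lt.le)
    have h1 : ((n / p : ℕ) : ℝ) ≤ padicValNat p n ! := by
      exact_mod_cast div_le_padicValNat_factorial hpp
    have h2 : (n : ℝ) / p < (n / p : ℕ) + 1 := Nat.lt_floor_add_one ((n : ℝ) / p) |>.trans_eq
      (by rw [Nat.floor_div_natCast, Nat.floor_natCast])
    calc (n : ℝ) * (log p / p) - log p = (n / p - 1) * log p := by ring
      _ ≤ _ := by gcongr; linarith
  have hB : log (n ! : ℝ) ≤ n * ∑ p ∈ Nat.primesLE n, log p / p + n * S := by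
    have h1 : ∑ p ∈ Nat.primesLE n, log p / (p * (p - 1) : ℝ) ≤ S :=
      summable_log_div_mul_sub_one.sum_le_tsum _ fun i _ => hS0 i
    calc log (n ! : ℝ) ≤ n * ∑ p ∈ Nat.primesLE n, log p / p +
          n * ∑ p ∈ Nat.primesLE n, log p / (p * (p - 1) : ℝ) := by
            rw [hfac, ← mul_add, ← Finset.sum_add_distrib, Finset.mul_sum]
            refine Finset.sum_le_sum fun p hp => ?_
            have hpp := Nat.prime_of_mem_primesLE hp
            have hp1 : (1 : ℝ) < p := by exact_mod_cast hpp.one_lt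
            have hl := log_nonneg hp1.le
            calc _ ≤ (n / (p - 1) : ℝ) * log p := by
                  gcongr; exact padicValNat_factorial_le_div_sub_one hpp
              _ = _ := by
                  have : (p : ℝ) - 1 ≠ 0 := by linarith
                  field_simp
                  ring
      _ ≤ _ := by gcongr
  have hth := Chebyshev.theta_le_log4_mul_x hn'.le
  have h4 := log_nonneg (show (1 : ℝ) ≤ 4 by norm_num)
  set T := ∑ p ∈ Nat.primesLE n, log p / p
  rw [abs_le]
  constructor
  · have : n * (-(1 + S) : ℝ) ≤ n * (T - log n) := by linarith
    have := le_of_mul_le_mul_left this hn'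
    linarith
  · have : n * (T - log n) ≤ n * log 4 := by linarith
    have := le_of_mul_le_mul_left this hn'
    linarith

theorem antitone_inv_log_max_two : Antitone fun n : ℕ => (log (max (n : ℝ) 2))⁻¹ := by
  intro a b hab
  have h : (a : ℝ) ≤ b := by exact_mod_cast hab
  have : 0 < log (max (a : ℝ) 2) := log_pos (by linarith [le_max_right (a : ℝ) 2])
  dsimp only
  gcongr

theorem tendsto_inv_log_max_two :
    Tendsto (fun n : ℕ => (log (max (n : ℝ) 2))⁻¹) atTop (𝓝 0) :=
  (tendsto_inv_atTop_zero.comp tendsto_log_atTop).comp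
    (tendsto_atTop_mono (fun _ => le_max_left _ _) tendsto_natCast_atTop_atTop)

theorem exists_tendsto_sum_inv_log_mul_sub :
    ∃ c, Tendsto (fun n : ℕ => ∑ i ∈ Finset.range n, (log (max (i : ℝ) 2))⁻¹ *
      ((if i.Prime then log i / i else 0) - (i : ℝ)⁻¹)) atTop (𝓝 c) := by
  obtain ⟨C, hC⟩ := exists_abs_sum_log_div_sub_log_le
  refine cauchySeq_tendsto_of_complete
    (antitone_inv_log_max_two.cauchySeq_series_mul_of_tendsto_zero_of_bounded
      (b := C + 1) tendsto_inv_log_max_two fun n => ?_)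
  rcases n with _ | n
  · have := (abs_nonneg _).trans (hC 0)
    simp
    linarith
  have h1 : ∑ i ∈ Finset.range (n + 1), (if i.Prime then log i / i else 0)
      = ∑ p ∈ Nat.primesLE n, log p / p := by
    rw [Nat.primesLE, Nat.primesBelow, Finset.sum_filter]
  have h2 : ∑ i ∈ Finset.range (n + 1), (i : ℝ)⁻¹ = (harmonic n : ℝ) := by
    rw [Finset.sum_range_succ', harmonic]
    simp
  have h3 : |(harmonic n : ℝ) - log n| ≤ 1 := by
    rcases Nat.eq_zero_or_pos n with rfl | hn
    · simp
    have ha := log_add_one_le_harmonic n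
    have hb := harmonic_le_one_add_log n
    have hc : log n ≤ log (n + 1 : ℕ) :=
      log_le_log (by exact_mod_cast hn) (by exact_mod_cast n.le_succ)
    rw [abs_le]
    constructor <;> linarith
  rw [Finset.sum_sub_distrib, h1, h2, Real.norm_eq_abs]
  calc _ = |(∑ p ∈ Nat.primesLE n, log p / p - log n) - ((harmonic n : ℝ) - log n)| := by
        congr 1; ring
    _ ≤ _ := abs_sub _ _
    _ ≤ _ := add_le_add (hC n) h3

theorem log_log_sub_le {x : ℝ} (hx : 2 ≤ x) :
    log (log (x + 1)) - log (log x) ≤ (log x)⁻¹ * x⁻¹ := by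
  have h0 : 0 < log x := log_pos (by linarith)
  have h1 : 0 < log (x + 1) := log_pos (by linarith)
  have h2 : log (x + 1) - log x ≤ x⁻¹ := by
    rw [← log_div (by linarith) (by linarith)]
    refine (log_le_sub_one_of_pos (by positivity)).trans_eq ?_
    field_simp
    ring
  rw [← log_div h1.ne' h0.ne']
  calc _ ≤ log (x + 1) / log x - 1 := log_le_sub_one_of_pos (by positivity)
    _ = (log x)⁻¹ * (log (x + 1) - log x) := by field_simp
    _ ≤ _ := by gcongr

theorem le_log_log_sub {x : ℝ} (hx : 2 ≤ x) :
    (log (x + 1))⁻¹ * (x + 1)⁻¹ ≤ log (log (x + 1)) - log (log x) := by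
  have h0 : 0 < log x := log_pos (by linarith)
  have h1 : 0 < log (x + 1) := log_pos (by linarith)
  have h2 : (x + 1)⁻¹ ≤ log (x + 1) - log x := by
    rw [← log_div (by linarith) (by linarith)]
    refine le_trans (le_of_eq ?_) (one_sub_inv_le_log_of_pos (by positivity))
    field_simp
    ring
  rw [← log_div h1.ne' h0.ne']
  calc _ ≤ (log (x + 1))⁻¹ * (log (x + 1) - log x) := by gcongr
    _ = 1 - (log (x + 1) / log x)⁻¹ := by field_simp
    _ ≤ _ := one_sub_inv_le_log_of_pos (by positivity)

theorem exists_tendsto_sum_inv_log_mul_inv_sub_log_log :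
    ∃ d, Tendsto (fun n : ℕ => ∑ i ∈ Finset.range n, (log (max (i : ℝ) 2))⁻¹ * (i : ℝ)⁻¹
      - log (log n)) atTop (𝓝 d) := by
  set q : ℕ → ℝ := fun n => ∑ i ∈ Finset.range n, (log (max (i : ℝ) 2))⁻¹ * (i : ℝ)⁻¹
      - log (log n) with hq
  have hcast : ∀ n : ℕ, (2 : ℝ) ≤ (n + 2 : ℕ) := fun n => by
    push_cast; linarith [n.cast_nonneg (α := ℝ)]
  have hsucc : ∀ n : ℕ, q (n + 2 + 1) = q (n + 2) + ((log (n + 2 : ℕ))⁻¹ * ((n + 2 : ℕ) : ℝ)⁻¹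
      - (log (log ((n + 2 : ℕ) + 1)) - log (log (n + 2 : ℕ)))) := fun n => by
    simp only [hq]
    rw [Finset.sum_range_succ, max_eq_left (hcast n), Nat.cast_succ (n + 2)]
    ring
  have hmono : Monotone fun n => q (n + 2) := monotone_nat_of_le_succ fun n => by
    have := log_log_sub_le (hcast n)
    have := hsucc n
    rw [show n + 1 + 2 = n + 2 + 1 by ring]
    linarith
  have hanti : Antitone fun n => q (n + 2) + (log (n + 2 : ℕ))⁻¹ * ((n + 2 : ℕ) : ℝ)⁻¹ :=
    antitone_nat_of_succ_le fun n => by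
      have h1 := le_log_log_sub (hcast n)
      have := hsucc n
      rw [show n + 1 + 2 = n + 2 + 1 by ring, Nat.cast_succ (n + 2)]
      linarith
  have hbdd : BddAbove (Set.range fun n => q (n + 2)) := by
    refine ⟨q (0 + 2) + (log (0 + 2 : ℕ))⁻¹ * ((0 + 2 : ℕ) : ℝ)⁻¹, ?_⟩
    rintro _ ⟨n, rfl⟩
    refine le_trans ?_ (hanti (Nat.zero_le n))
    have := log_nonneg (show (1 : ℝ) ≤ (n + 2 : ℕ) by linarith [hcast n])
    have : 0 ≤ (log (n + 2 : ℕ))⁻¹ * ((n + 2 : ℕ) : ℝ)⁻¹ := by positivity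
    dsimp only
    linarith
  exact ⟨_, (tendsto_add_atTop_iff_nat 2).1 (tendsto_atTop_ciSup hmono hbdd)⟩

theorem exists_tendsto_sum_prime_inv_sub_log_log :
    ∃ M, Tendsto (fun n : ℕ => ∑ i ∈ Finset.range n, (if i.Prime then (i : ℝ)⁻¹ else 0)
      - log (log n)) atTop (𝓝 M) := by
  obtain ⟨c, hc⟩ := exists_tendsto_sum_inv_log_mul_sub
  obtain ⟨d, hd⟩ := exists_tendsto_sum_inv_log_mul_inv_sub_log_log
  refine ⟨c + d, (hc.add hd).congr fun n => ?_⟩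
  rw [← add_sub_assoc, ← Finset.sum_add_distrib]
  congr 1
  refine Finset.sum_congr rfl fun i _ => ?_
  split_ifs with hi
  · have h2 : (2 : ℝ) ≤ i := by exact_mod_cast hi.two_le
    have := log_pos (show (1 : ℝ) < i by linarith)
    rw [max_eq_left h2]
    field_simp
    ring
  · ring

theorem prime_rpow_mem_Ioc {p : ℕ} (hp : p.Prime) {s : ℝ} (hs : 1 ≤ s) :
    (p : ℝ) ^ (-s) ∈ Set.Ioc 0 (1 / 2 : ℝ) := by
  have h2 : (2 : ℝ) ≤ p := by exact_mod_cast hp.two_le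
  refine ⟨by positivity, ?_⟩
  calc (p : ℝ) ^ (-s) ≤ (p : ℝ) ^ (-1 : ℝ) :=
        rpow_le_rpow_of_exponent_le (by linarith) (by linarith)
    _ = 1 / p := by rw [rpow_neg_one, one_div]
    _ ≤ _ := by gcongr

theorem hasSum_prime_neg_log_one_sub_rpow {s : ℝ} (hs : 1 < s) :
    HasSum (fun i : ℕ => if i.Prime then -log (1 - (i : ℝ) ^ (-s)) else 0)
      (log (riemannZeta s).re) := by
  have hnn : ∀ i : ℕ, 0 ≤ if i.Prime then -log (1 - (i : ℝ) ^ (-s)) else 0 := fun i => by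
    split_ifs with hi
    · have := prime_rpow_mem_Ioc hi hs.le
      have := log_nonpos (x := 1 - (i : ℝ) ^ (-s)) (by linarith [this.2]) (by linarith [this.1])
      linarith
    · exact le_rfl
  rw [hasSum_iff_tendsto_nat_of_nonneg hnn]
  have h1 := riemannZeta_eulerProduct (s := s) (by simpa using hs)
  have h2 := (Complex.continuous_re.tendsto _).comp h1
  have h3 := (continuousAt_log (riemannZeta_re_pos_of_one_lt hs).ne').tendsto.comp h2
  refine h3.congr fun n => ?_
  have h4 : ∏ p ∈ Nat.primesBelow n, (1 - (p : ℂ) ^ (-(s : ℂ)))⁻¹ =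
      ((∏ p ∈ Nat.primesBelow n, (1 - (p : ℝ) ^ (-s))⁻¹ : ℝ) : ℂ) := by
    push_cast
    refine Finset.prod_congr rfl fun p _ => ?_
    rw [Complex.ofReal_cpow (by positivity)]
    simp
  simp only [Function.comp_apply, h4, Complex.ofReal_re]
  rw [log_prod, Nat.primesBelow, Finset.sum_filter]
  · simp only [log_inv]
  · intro p hp
    have := prime_rpow_mem_Ioc (Nat.prime_of_mem_primesBelow hp) hs.le
    have : 0 < 1 - (p : ℝ) ^ (-s) := by linarith [this.2]
    positivity

theorem neg_log_one_sub_sub_mem_Icc {u : ℝ} (hu : u ∈ Set.Ioc 0 (1 / 2 : ℝ)) :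
    -log (1 - u) - u ∈ Set.Icc 0 (2 * u ^ 2) := by
  obtain ⟨h0, h1⟩ := hu
  have ha := log_le_sub_one_of_pos (show 0 < 1 - u by linarith)
  have hb := one_sub_inv_le_log_of_pos (show 0 < 1 - u by linarith)
  refine ⟨by linarith, ?_⟩
  have hc : (1 - u)⁻¹ ≤ 1 + u + 2 * u ^ 2 := by
    rw [inv_le_iff_one_le_mul₀ (by linarith)]
    nlinarith [mul_nonneg (sq_nonneg u) (show 0 ≤ 1 - 2 * u by linarith)]
  linarith

theorem norm_prime_log_remainder_le (s : ℝ) (hs : 1 ≤ s) (i : ℕ) :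
    ‖if i.Prime then -log (1 - (i : ℝ) ^ (-s)) - (i : ℝ) ^ (-s) else 0‖
      ≤ 2 * (1 / (i : ℝ) ^ 2) := by
  split_ifs with hi
  · have h := prime_rpow_mem_Ioc hi hs
    have h' := neg_log_one_sub_sub_mem_Icc h
    have h2 : (2 : ℝ) ≤ i := by exact_mod_cast hi.two_le
    rw [Real.norm_eq_abs, abs_of_nonneg h'.1]
    refine h'.2.trans ?_
    have : (i : ℝ) ^ (-s) ≤ (i : ℝ)⁻¹ := by
      rw [← rpow_neg_one]
      exact rpow_le_rpow_of_exponent_le (by linarith) (by linarith)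
    rw [one_div, ← inv_pow]
    gcongr
  · simp

theorem summable_two_mul_one_div_sq : Summable fun i : ℕ => 2 * (1 / (i : ℝ) ^ 2) :=
  (Real.summable_one_div_nat_pow.2 one_lt_two).mul_left 2

theorem tendsto_tsum_prime_log_remainder :
    Tendsto (fun s : ℝ => ∑' i : ℕ,
        if i.Prime then -log (1 - (i : ℝ) ^ (-s)) - (i : ℝ) ^ (-s) else 0) (𝓝[>] 1)
      (𝓝 (∑' i : ℕ, if i.Prime then -log (1 - (i : ℝ)⁻¹) - (i : ℝ)⁻¹ else 0)) := by
  refine tendsto_tsum_of_dominated_convergence summable_two_mul_one_div_sq (fun i => ?_) ?_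
  · by_cases hi : i.Prime
    · simp only [hi, if_true]
      have hi0 : (i : ℝ) ≠ 0 := by exact_mod_cast hi.ne_zero
      have h1 : Tendsto (fun s : ℝ => (i : ℝ) ^ (-s)) (𝓝[>] 1) (𝓝 (i : ℝ)⁻¹) := by
        have : ContinuousAt (fun s : ℝ => (i : ℝ) ^ (-s)) 1 :=
          (continuousAt_const_rpow hi0).comp continuousAt_neg
        have h := this.tendsto.mono_left (nhdsWithin_le_nhds (s := Set.Ioi 1))
        rwa [rpow_neg_one] at h
      have h2 : 1 - (i : ℝ)⁻¹ ≠ 0 := by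
        have := (prime_rpow_mem_Ioc hi le_rfl).2
        rw [rpow_neg_one] at this
        linarith
      exact ((h1.const_sub 1).log h2).neg.sub h1
    · simp [hi]
  · filter_upwards [self_mem_nhdsWithin] with s hs i
    exact norm_prime_log_remainder_le s (le_of_lt hs) i

theorem summable_prime_log_remainder {s : ℝ} (hs : 1 ≤ s) :
    Summable fun i : ℕ => if i.Prime then -log (1 - (i : ℝ) ^ (-s)) - (i : ℝ) ^ (-s) else 0 :=
  summable_two_mul_one_div_sq.of_norm_bounded (norm_prime_log_remainder_le s hs)

theorem hasSum_prime_rpow_neg {s : ℝ} (hs : 1 < s) :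
    HasSum (fun i : ℕ => if i.Prime then (i : ℝ) ^ (-s) else 0)
      (log (riemannZeta s).re - ∑' i : ℕ,
        if i.Prime then -log (1 - (i : ℝ) ^ (-s)) - (i : ℝ) ^ (-s) else 0) := by
  refine ((hasSum_prime_neg_log_one_sub_rpow hs).sub
    (summable_prime_log_remainder hs.le).hasSum).congr_fun fun i => ?_
  split_ifs <;> ring

theorem tendsto_tsum_prime_rpow_neg_add_log :
    Tendsto (fun s : ℝ => (∑' i : ℕ, if i.Prime then (i : ℝ) ^ (-s) else 0) + log (s - 1))
      (𝓝[>] 1)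
      (𝓝 (-∑' i : ℕ, if i.Prime then -log (1 - (i : ℝ)⁻¹) - (i : ℝ)⁻¹ else 0)) := by
  have h1 := (Asymptotics.isLittleO_one_iff ℝ).1 log_riemannZeta_add_log_sub_isLittleO_ofReal
  have h2 := h1.sub tendsto_tsum_prime_log_remainder
  rw [zero_sub] at h2
  refine h2.congr' ?_
  filter_upwards [self_mem_nhdsWithin] with s hs
  rw [(hasSum_prime_rpow_neg hs).tsum_eq]
  ring

/-- The total mass of `1 / p` over the primes `p` with `exp (c - 1) < p ≤ exp c`. -/
noncomputable def primeInvBlock (c : ℕ) : ℝ :=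
  ∑' i : (fun i : ℕ => ⌈log i⌉₊) ⁻¹' {c}, if (i : ℕ).Prime then ((i : ℕ) : ℝ)⁻¹ else 0

theorem prime_inv_mul_exp_pow_mem_Icc {s : ℝ} (hs : 1 < s) (i : ℕ) :
    (if i.Prime then (i : ℝ)⁻¹ else 0) * exp (1 - s) ^ ⌈log i⌉₊ ∈
      Set.Icc (exp (1 - s) * if i.Prime then (i : ℝ) ^ (-s) else 0)
        (if i.Prime then (i : ℝ) ^ (-s) else 0) := by
  split_ifs with hi
  · have hi0 : (0 : ℝ) < i := by exact_mod_cast hi.pos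
    have h1 : (i : ℝ) ^ (-s) = (i : ℝ)⁻¹ * exp ((1 - s) * log i) := by
      rw [← rpow_neg_one, rpow_def_of_pos hi0, rpow_def_of_pos hi0, ← exp_add]
      ring_nf
    have h2 := Nat.le_ceil (log i)
    have h3 := Nat.ceil_lt_add_one (log_nonneg (show (1 : ℝ) ≤ i by exact_mod_cast hi.one_lt.le))
    rw [h1, ← exp_nat_mul, mul_left_comm, ← exp_add]
    constructor <;> refine mul_le_mul_of_nonneg_left (exp_le_exp.2 ?_) (by positivity) <;>
      nlinarith
  · simp

theorem summable_prime_inv_mul_exp_pow {s : ℝ} (hs : 1 < s) :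
    Summable fun i : ℕ => (if i.Prime then (i : ℝ)⁻¹ else 0) * exp (1 - s) ^ ⌈log i⌉₊ :=
  Summable.of_nonneg_of_le (fun i => mul_nonneg (by split_ifs <;> positivity) (by positivity))
    (fun i => (prime_inv_mul_exp_pow_mem_Icc hs i).2) (hasSum_prime_rpow_neg hs).summable

theorem hasSum_primeInvBlock_mul_exp_pow {s : ℝ} (hs : 1 < s) :
    HasSum (fun c => primeInvBlock c * exp (1 - s) ^ c)
      (∑' i : ℕ, (if i.Prime then (i : ℝ)⁻¹ else 0) * exp (1 - s) ^ ⌈log i⌉₊) := by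
  refine ((summable_prime_inv_mul_exp_pow hs).hasSum.tsum_fiberwise
    (fun i : ℕ => ⌈log i⌉₊)).congr_fun fun c => ?_
  rw [primeInvBlock, ← tsum_mul_right]
  refine tsum_congr fun i => ?_
  have : ⌈log (i : ℕ)⌉₊ = c := i.2
  rw [this]

theorem sum_range_primeInvBlock (n : ℕ) :
    ∑ c ∈ Finset.range (n + 1), primeInvBlock c =
      ∑ i ∈ Finset.range (⌊exp n⌋₊ + 1), if i.Prime then (i : ℝ)⁻¹ else 0 := by
  have hmem : ∀ i : ℕ, ⌈log i⌉₊ ≤ n ↔ i < ⌊exp n⌋₊ + 1 := fun i => by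
    rw [Nat.ceil_le, Nat.lt_succ_iff, Nat.le_floor_iff (exp_pos _).le]
    rcases Nat.eq_zero_or_pos i with rfl | hi
    · simp [exp_nonneg]
    · rw [log_le_iff_le_exp (by exact_mod_cast hi)]
  rw [← Finset.sum_fiberwise_of_maps_to (g := fun i : ℕ => ⌈log i⌉₊)
    (s := Finset.range (⌊exp n⌋₊ + 1)) (t := Finset.range (n + 1))]
  · refine Finset.sum_congr rfl fun c hc => ?_
    rw [primeInvBlock, tsum_subtype ((fun i : ℕ => ⌈log i⌉₊) ⁻¹' {c})
      (fun i : ℕ => if i.Prime then (i : ℝ)⁻¹ else 0),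
      tsum_eq_sum (s := Finset.range (⌊exp n⌋₊ + 1)), Finset.sum_filter]
    · refine Finset.sum_congr rfl fun i _ => ?_
      by_cases h : ⌈log i⌉₊ = c
      · rw [if_pos h, Set.indicator_of_mem (by exact h)]
      · rw [if_neg h, Set.indicator_of_notMem (by exact h)]
    · intro i hi
      refine Set.indicator_of_notMem (fun h => hi ?_) _
      have h : ⌈log i⌉₊ = c := h
      rw [Finset.mem_range] at hc ⊢
      rw [← hmem]
      omega
  · intro i hi
    rw [Finset.mem_range] at hi ⊢
    rw [← hmem] at hi
    omega

theorem tendsto_sub_one_nhdsGT_one : Tendsto (fun s : ℝ => s - 1) (𝓝[>] 1) (𝓝[>] 0) := by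
  refine tendsto_nhdsWithin_iff.2 ⟨?_, ?_⟩
  · have : Tendsto (fun s : ℝ => s - 1) (𝓝 1) (𝓝 (1 - 1)) := tendsto_id.sub_const 1
    rw [sub_self] at this
    exact this.mono_left nhdsWithin_le_nhds
  · filter_upwards [self_mem_nhdsWithin] with s hs
    exact sub_pos.2 (Set.mem_Ioi.1 hs)

theorem tendsto_tsum_prime_inv_mul_exp_pow_add_log :
    Tendsto (fun s : ℝ => (∑' i : ℕ, (if i.Prime then (i : ℝ)⁻¹ else 0) *
        exp (1 - s) ^ ⌈log i⌉₊) + log (s - 1)) (𝓝[>] 1)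
      (𝓝 (-∑' i : ℕ, if i.Prime then -log (1 - (i : ℝ)⁻¹) - (i : ℝ)⁻¹ else 0)) := by
  have hQ := tendsto_tsum_prime_rpow_neg_add_log
  have hδ : Tendsto (fun s : ℝ => s - 1) (𝓝[>] 1) (𝓝 0) :=
    tendsto_sub_one_nhdsGT_one.mono_right nhdsWithin_le_nhds
  have hlog := (tendsto_log_mul_rpow_nhdsGT_zero zero_lt_one).comp tendsto_sub_one_nhdsGT_one
  have hlow := hQ.sub ((hδ.mul hQ).sub hlog)
  rw [zero_mul, sub_zero, sub_zero] at hlow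
  refine tendsto_of_tendsto_of_tendsto_of_le_of_le' hlow hQ ?_ ?_
  · filter_upwards [self_mem_nhdsWithin] with s hs
    have h1 := (hasSum_prime_rpow_neg hs).summable
    have h2 := (h1.mul_left (exp (1 - s))).tsum_le_tsum
      (fun i => (prime_inv_mul_exp_pow_mem_Icc hs i).1) (summable_prime_inv_mul_exp_pow hs)
    rw [tsum_mul_left] at h2
    have h3 : 0 ≤ ∑' i : ℕ, if i.Prime then (i : ℝ) ^ (-s) else 0 :=
      tsum_nonneg fun i => by split_ifs <;> positivity
    have h4 := add_one_le_exp (1 - s)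
    simp only [Function.comp_apply, rpow_one]
    nlinarith
  · filter_upwards [self_mem_nhdsWithin] with s hs
    exact add_le_add ((summable_prime_inv_mul_exp_pow hs).tsum_le_tsum
      (fun i => (prime_inv_mul_exp_pow_mem_Icc hs i).2) (hasSum_prime_rpow_neg hs).summable) le_rfl

theorem tendsto_neg_log_one_sub_exp_add_log :
    Tendsto (fun s : ℝ => -log (1 - exp (1 - s)) + log (s - 1)) (𝓝[>] 1) (𝓝 0) := by
  refine tendsto_of_tendsto_of_tendsto_of_le_of_le' tendsto_const_nhds
    (tendsto_sub_one_nhdsGT_one.mono_right nhdsWithin_le_nhds) ?_ ?_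
  · filter_upwards [self_mem_nhdsWithin] with s hs
    have hs : 1 < s := hs
    have h1 := add_one_le_exp (1 - s)
    have h2 : exp (1 - s) < 1 := by rw [exp_lt_one_iff]; linarith
    have := log_le_log (show 0 < 1 - exp (1 - s) by linarith)
      (show 1 - exp (1 - s) ≤ s - 1 by linarith)
    linarith
  · filter_upwards [self_mem_nhdsWithin] with s hs
    have hs : 1 < s := hs
    have h1 := add_one_le_exp (s - 1)
    have h2 : exp (1 - s) * exp (s - 1) = 1 := by rw [← exp_add]; simp
    have h3 := exp_pos (1 - s)
    have := log_le_log (show 0 < (s - 1) * exp (1 - s) from mul_pos (by linarith) h3)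
      (show (s - 1) * exp (1 - s) ≤ 1 - exp (1 - s) by nlinarith)
    rw [log_mul (by linarith) h3.ne', log_exp] at this
    linarith

theorem tendsto_sum_prime_inv_floor_exp_sub_harmonic {M : ℝ}
    (hM : Tendsto (fun n : ℕ => ∑ i ∈ Finset.range n, (if i.Prime then (i : ℝ)⁻¹ else 0)
      - log (log n)) atTop (𝓝 M)) :
    Tendsto (fun n : ℕ => ∑ c ∈ Finset.range n, (primeInvBlock c - (c : ℝ)⁻¹)) atTop
      (𝓝 (M - eulerMascheroniConstant)) := by
  rw [← tendsto_add_atTop_iff_nat 1]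
  have hN : Tendsto (fun n : ℕ => ⌊exp n⌋₊ + 1) atTop atTop :=
    (tendsto_add_atTop_nat 1).comp (tendsto_nat_floor_atTop.comp
      (tendsto_exp_atTop.comp tendsto_natCast_atTop_atTop))
  have hll : Tendsto (fun n : ℕ => log (log (⌊exp n⌋₊ + 1 : ℕ)) - log n) atTop (𝓝 0) := by
    refine tendsto_of_tendsto_of_tendsto_of_le_of_le' tendsto_const_nhds
      tendsto_log_nat_add_one_sub_log ?_ ?_
    · filter_upwards [eventually_gt_atTop 0] with n hn
      have hn' : (0 : ℝ) < n := by exact_mod_cast hn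
      have h1 : exp n ≤ (⌊exp n⌋₊ + 1 : ℕ) := by
        push_cast; exact (Nat.lt_floor_add_one _).le
      have h2 : (n : ℝ) ≤ log (⌊exp n⌋₊ + 1 : ℕ) := by
        rwa [le_log_iff_exp_le (lt_of_lt_of_le (exp_pos _) h1)]
      exact sub_nonneg.2 (log_le_log hn' h2)
    · filter_upwards [eventually_gt_atTop 0] with n hn
      have hn' : (0 : ℝ) < n := by exact_mod_cast hn
      have h0 := Nat.floor_le (exp_pos (n : ℝ)).le
      have h1 : ((⌊exp n⌋₊ + 1 : ℕ) : ℝ) ≤ exp (n + 1) := by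
        rw [exp_add]
        push_cast
        nlinarith [add_one_le_exp (1 : ℝ), one_le_exp hn'.le]
      have h2 : log (⌊exp n⌋₊ + 1 : ℕ) ≤ n + 1 := by
        rwa [log_le_iff_le_exp (by positivity)]
      have h3 : 1 < ((⌊exp n⌋₊ + 1 : ℕ) : ℝ) := by
        have : 0 < ⌊exp n⌋₊ := Nat.floor_pos.2 (one_le_exp hn'.le)
        exact_mod_cast Nat.lt_add_of_pos_left this
      gcongr
      exact log_pos h3
  have h := ((hM.comp hN).add hll).sub tendsto_harmonic_sub_log
  rw [add_zero] at h
  refine h.congr fun n => ?_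
  have hH : ∑ c ∈ Finset.range (n + 1), (c : ℝ)⁻¹ = (harmonic n : ℝ) := by
    rw [Finset.sum_range_succ', harmonic]
    simp
  rw [Finset.sum_sub_distrib, sum_range_primeInvBlock, hH]
  simp only [Function.comp_apply]
  ring

theorem tendsto_sum_prime_inv_sub_log_log :
    Tendsto (fun n : ℕ => ∑ i ∈ Finset.range n, (if i.Prime then (i : ℝ)⁻¹ else 0)
      - log (log n)) atTop (𝓝 (eulerMascheroniConstant -
        ∑' i : ℕ, if i.Prime then -log (1 - (i : ℝ)⁻¹) - (i : ℝ)⁻¹ else 0)) := by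
  obtain ⟨M, hM⟩ := exists_tendsto_sum_prime_inv_sub_log_log
  convert hM using 2
  have hexp : Tendsto (fun s : ℝ => exp (1 - s)) (𝓝[>] 1) (𝓝[<] 1) := by
    refine tendsto_nhdsWithin_iff.2 ⟨?_, ?_⟩
    · have : Tendsto (fun s : ℝ => exp (1 - s)) (𝓝 1) (𝓝 (exp (1 - 1))) :=
        (Continuous.tendsto (by fun_prop) 1)
      rw [sub_self, exp_zero] at this
      exact this.mono_left nhdsWithin_le_nhds
    · filter_upwards [self_mem_nhdsWithin] with s hs
      exact exp_lt_one_iff.2 (sub_neg.2 (Set.mem_Ioi.1 hs))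
  have hA := (tendsto_tsum_powerSeries_nhdsWithin_lt
    (tendsto_sum_prime_inv_floor_exp_sub_harmonic hM)).comp hexp
  have hB := tendsto_tsum_prime_inv_mul_exp_pow_add_log.sub tendsto_neg_log_one_sub_exp_add_log
  have := tendsto_nhds_unique hA (hB.congr' ?_)
  · linarith
  filter_upwards [self_mem_nhdsWithin] with s hs
  have hs : 1 < s := hs
  have hx1 : exp (1 - s) < 1 := exp_lt_one_iff.2 (sub_neg.2 hs)
  have hlog : HasSum (fun c : ℕ => (c : ℝ)⁻¹ * exp (1 - s) ^ c) (-log (1 - exp (1 - s))) := by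
    rw [← hasSum_nat_add_iff' 1]
    simp only [Finset.range_one, Finset.sum_singleton, Nat.cast_zero, inv_zero, zero_mul, sub_zero]
    refine (hasSum_pow_div_log_of_abs_lt_one
      (x := exp (1 - s)) (by rwa [abs_of_pos (exp_pos _)])).congr_fun fun c => ?_
    push_cast
    rw [div_eq_inv_mul]
  have := (hasSum_primeInvBlock_mul_exp_pow hs).sub hlog
  simp only [Function.comp_apply, sub_mul]
  rw [this.tsum_eq]
  ring

/-- **Mertens' third theorem**. -/
theorem tendsto_prod_primesBelow_mul_log :
    Tendsto (fun n : ℕ => (∏ p ∈ Nat.primesBelow n, (1 - (p : ℝ)⁻¹)) * log n) atTop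
      (𝓝 (exp (-eulerMascheroniConstant))) := by
  have hs := (summable_prime_log_remainder le_rfl).hasSum.tendsto_sum_nat
  simp only [rpow_neg_one] at hs
  have h := (tendsto_sum_prime_inv_sub_log_log.add hs).neg
  rw [sub_add_cancel] at h
  refine ((continuous_exp.tendsto _).comp h).congr' ?_
  filter_upwards [eventually_gt_atTop 1] with n hn
  have hlog : 0 < log n := log_pos (by exact_mod_cast hn)
  have hpos : ∀ p ∈ Nat.primesBelow n, 0 < 1 - (p : ℝ)⁻¹ := fun p hp => by
    have : (1 : ℝ) < p := by exact_mod_cast (Nat.prime_of_mem_primesBelow hp).one_lt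
    linarith [inv_lt_one_of_one_lt₀ this]
  rw [← exp_log (mul_pos (Finset.prod_pos hpos) hlog),
    log_mul (Finset.prod_pos hpos).ne' hlog.ne', log_prod fun p hp => (hpos p hp).ne',
    Nat.primesBelow, Finset.sum_filter, Function.comp_apply, sub_add_eq_add_sub,
    ← Finset.sum_add_distrib, neg_sub, sub_eq_neg_add, ← Finset.sum_neg_distrib]
  congr 2
  refine Finset.sum_congr rfl fun i _ => ?_
  split_ifs <;> ring

theorem prime_one_sub_inv_mem_Ioo {p : ℕ} (hp : p.Prime) : 1 - (p : ℝ)⁻¹ ∈ Set.Ioo 0 1 := by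
  have h1 : (1 : ℝ) < p := by exact_mod_cast hp.one_lt
  have h2 : 0 < (p : ℝ)⁻¹ := by positivity
  exact ⟨by linarith [inv_lt_one_of_one_lt₀ h1], by linarith⟩

theorem pow_card_primeFactors_ge_le {m n : ℕ} (hn : n ≠ 0) :
    m ^ (n.primeFactors.filter (m ≤ ·)).card ≤ n :=
  calc m ^ (n.primeFactors.filter (m ≤ ·)).card ≤ ∏ p ∈ n.primeFactors.filter (m ≤ ·), p :=
        Finset.pow_card_le_prod _ _ _ fun _ hp => (Finset.mem_filter.1 hp).2
    _ ≤ n := Nat.le_of_dvd (Nat.pos_of_ne_zero hn)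
        ((Finset.prod_dvd_prod_of_subset _ _ _ (Finset.filter_subset _ _)).trans
          (Nat.prod_primeFactors_dvd n))

theorem prod_primesBelow_mul_pow_le_prod_primeFactors (n : ℕ) {m : ℕ} (hm : 1 ≤ m) :
    (∏ p ∈ Nat.primesBelow m, (1 - (p : ℝ)⁻¹)) *
      (1 - (m : ℝ)⁻¹) ^ (n.primeFactors.filter (m ≤ ·)).card ≤
      ∏ p ∈ n.primeFactors, (1 - (p : ℝ)⁻¹) := by
  have hm' : (1 : ℝ) ≤ m := by exact_mod_cast hm
  have hm0 : 0 ≤ 1 - (m : ℝ)⁻¹ := by linarith [inv_le_one_of_one_le₀ hm']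
  rw [← Finset.prod_filter_mul_prod_filter_not n.primeFactors (m ≤ ·), mul_comm,
    ← Finset.prod_const]
  refine mul_le_mul ?_ ?_ (Finset.prod_nonneg fun p hp => ?_) (Finset.prod_nonneg fun p hp => ?_)
  · refine Finset.prod_le_prod (fun _ _ => hm0) fun p hp => ?_
    have : (m : ℝ) ≤ p := by exact_mod_cast (Finset.mem_filter.1 hp).2
    gcongr
  · have hsub : n.primeFactors.filter (¬ m ≤ ·) ⊆ Nat.primesBelow m := fun p hp => by
      rw [Finset.mem_filter] at hp
      exact Nat.mem_primesBelow.2 ⟨not_le.1 hp.2, Nat.prime_of_mem_primeFactors hp.1⟩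
    rw [← Finset.prod_sdiff hsub]
    refine mul_le_of_le_one_left (Finset.prod_nonneg fun p hp => ?_)
      (Finset.prod_le_one (fun p hp => ?_) fun p hp => ?_)
    · exact (prime_one_sub_inv_mem_Ioo (Nat.prime_of_mem_primesBelow (hsub hp))).1.le
    · exact (prime_one_sub_inv_mem_Ioo
        (Nat.prime_of_mem_primesBelow (Finset.mem_sdiff.1 hp).1)).1.le
    · exact (prime_one_sub_inv_mem_Ioo
        (Nat.prime_of_mem_primesBelow (Finset.mem_sdiff.1 hp).1)).2.le
  · exact (prime_one_sub_inv_mem_Ioo (Nat.prime_of_mem_primesBelow hp)).1.le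
  · exact (prime_one_sub_inv_mem_Ioo
      (Nat.prime_of_mem_primeFactors (Finset.mem_filter.1 hp).1)).1.le

theorem prod_primesBelow_mul_le_prod_primeFactors_mul_log_log {n : ℕ} (hn : n ≠ 0)
    (hm : 2 ≤ ⌊log n⌋₊) :
    (∏ p ∈ Nat.primesBelow ⌊log n⌋₊, (1 - (p : ℝ)⁻¹)) * log ⌊log n⌋₊ *
      (1 - 2 * (log ⌊log n⌋₊)⁻¹) ≤
      (∏ p ∈ n.primeFactors, (1 - (p : ℝ)⁻¹)) * log (log n) := by
  set m := ⌊log n⌋₊ with hmdef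
  set k := (n.primeFactors.filter (m ≤ ·)).card with hk
  have hm2 : (2 : ℝ) ≤ m := by exact_mod_cast hm
  have hlogm : 0 < log m := log_pos (by linarith)
  have hmle : (m : ℝ) ≤ log n := by
    refine Nat.floor_le (not_lt.1 fun h => ?_)
    rw [hmdef, Nat.floor_of_nonpos h.le] at hm
    omega
  have hk1 : k * log m ≤ log n := by
    rw [← log_pow]
    exact log_le_log (by positivity) (by exact_mod_cast pow_card_primeFactors_ge_le hn)
  have hlt : log n ≤ 2 * m := by linarith [Nat.lt_floor_add_one (log n)]
  have hk2 : (k : ℝ) * (m : ℝ)⁻¹ ≤ 2 * (log m)⁻¹ := by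
    rw [← div_eq_mul_inv, ← div_eq_mul_inv, div_le_div_iff₀ (by linarith) hlogm]
    linarith
  have hbern : 1 - 2 * (log m)⁻¹ ≤ (1 - (m : ℝ)⁻¹) ^ k := by
    have h1 : (m : ℝ)⁻¹ ≤ 1 := inv_le_one_of_one_le₀ (by linarith)
    have := one_add_mul_le_pow (a := -(m : ℝ)⁻¹) (by linarith) k
    rw [← sub_eq_add_neg] at this
    linarith
  have hP : 0 ≤ ∏ p ∈ Nat.primesBelow m, (1 - (p : ℝ)⁻¹) := Finset.prod_nonneg fun p hp =>
    (prime_one_sub_inv_mem_Ioo (Nat.prime_of_mem_primesBelow hp)).1.le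
  calc _ ≤ (∏ p ∈ Nat.primesBelow m, (1 - (p : ℝ)⁻¹)) * log m * (1 - (m : ℝ)⁻¹) ^ k := by gcongr
    _ = ((∏ p ∈ Nat.primesBelow m, (1 - (p : ℝ)⁻¹)) * (1 - (m : ℝ)⁻¹) ^ k) * log m := by ring
    _ ≤ _ := by
      refine mul_le_mul (prod_primesBelow_mul_pow_le_prod_primeFactors n (by omega))
        (log_le_log (by linarith) hmle) hlogm.le (Finset.prod_nonneg fun p hp =>
          (prime_one_sub_inv_mem_Ioo (Nat.prime_of_mem_primeFactors hp)).1.le)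

theorem log_log_primorial_le {m : ℕ} (hm : 2 ≤ m) :
    log (log (primorial m)) ≤ log (m + 1 : ℕ) + log 2 := by
  have h1 := Chebyshev.theta_eq_log_primorial m
  rw [Nat.floor_natCast] at h1
  have h2 := Chebyshev.theta_pos (x := m) (by exact_mod_cast hm)
  have h3 := Chebyshev.theta_le_log4_mul_x (x := m) (by positivity)
  have h4 : log 4 ≤ 2 := by
    rw [show (4 : ℝ) = 2 ^ 2 by norm_num, log_pow]
    push_cast
    linarith [log_two_lt_d9]
  rw [← h1, ← log_mul (by positivity) (by norm_num)]
  refine log_le_log h2 (h3.trans ?_)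
  push_cast
  nlinarith [m.cast_nonneg (α := ℝ)]

theorem unitary_phi_eq_mul_prod
    {φs : ℕ → ℝ} (h1 : φs 1 = 1)
    (hm : ∀ m n : ℕ, Nat.Coprime m n → φs (m * n) = φs m * φs n)
    (hpp : ∀ p ν : ℕ, p.Prime → 1 ≤ ν → φs (p ^ ν) = (p : ℝ) ^ ν - 1)
    {n : ℕ} (hn : n ≠ 0) :
    φs n = n * ∏ p ∈ n.primeFactors, (1 - ((p : ℝ) ^ n.factorization p)⁻¹) := by
  conv_lhs => rw [Nat.multiplicative_factorization φs hm h1 hn]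
  have h : (n : ℝ) = ∏ p ∈ n.primeFactors, (p : ℝ) ^ n.factorization p := by
    conv_lhs => rw [← Nat.prod_factorization_pow_eq_self hn]
    rw [Finsupp.prod]
    push_cast
    rfl
  conv_rhs => rw [h]
  rw [← Finset.prod_mul_distrib]
  refine Finset.prod_congr rfl fun p hp => ?_
  have hp' := Nat.prime_of_mem_primeFactors hp
  have h0 : (p : ℝ) ≠ 0 := by exact_mod_cast hp'.ne_zero
  beta_reduce
  rw [hpp p _ hp' (hp'.factorization_pos_of_dvd hn (Nat.dvd_of_mem_primeFactors hp))]
  field_simp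

theorem mul_prod_le_unitary_phi
    {φs : ℕ → ℝ} (h1 : φs 1 = 1)
    (hm : ∀ m n : ℕ, Nat.Coprime m n → φs (m * n) = φs m * φs n)
    (hpp : ∀ p ν : ℕ, p.Prime → 1 ≤ ν → φs (p ^ ν) = (p : ℝ) ^ ν - 1)
    {n : ℕ} (hn : n ≠ 0) :
    n * ∏ p ∈ n.primeFactors, (1 - (p : ℝ)⁻¹) ≤ φs n := by
  rw [unitary_phi_eq_mul_prod h1 hm hpp hn]
  refine mul_le_mul_of_nonneg_left (Finset.prod_le_prod (fun p hp => ?_) fun p hp => ?_)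
    n.cast_nonneg
  · exact (prime_one_sub_inv_mem_Ioo (Nat.prime_of_mem_primeFactors hp)).1.le
  · have hp' := Nat.prime_of_mem_primeFactors hp
    have h0 : (1 : ℝ) ≤ p := by exact_mod_cast hp'.one_lt.le
    have := le_self_pow₀ h0
      (hp'.factorization_pos_of_dvd hn (Nat.dvd_of_mem_primeFactors hp)).ne'
    gcongr

theorem unitary_phi_prod_primes
    {φs : ℕ → ℝ} (h1 : φs 1 = 1)
    (hm : ∀ m n : ℕ, Nat.Coprime m n → φs (m * n) = φs m * φs n)
    (hpp : ∀ p ν : ℕ, p.Prime → 1 ≤ ν → φs (p ^ ν) = (p : ℝ) ^ ν - 1)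
    {s : Finset ℕ} (hs : ∀ p ∈ s, p.Prime) :
    φs (∏ p ∈ s, p) = ((∏ p ∈ s, p : ℕ) : ℝ) * ∏ p ∈ s, (1 - (p : ℝ)⁻¹) := by
  induction s using Finset.induction_on with
  | empty => simp [h1]
  | insert q s hq ih =>
    have hqp := hs q (Finset.mem_insert_self q s)
    have hsp : ∀ p ∈ s, p.Prime := fun p hp => hs p (Finset.mem_insert_of_mem hp)
    have hcop : Nat.Coprime q (∏ p ∈ s, p) := Nat.Coprime.prod_right fun p hp =>
      (Nat.coprime_primes hqp (hsp p hp)).2 fun h => hq (h ▸ hp)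
    have hφ := hpp q 1 hqp le_rfl
    rw [pow_one, pow_one] at hφ
    have h0 : (q : ℝ) ≠ 0 := by exact_mod_cast hqp.ne_zero
    rw [Finset.prod_insert hq, Finset.prod_insert hq, hm _ _ hcop, ih hsp, hφ]
    push_cast
    field_simp

theorem eventually_le_unitary_phi_mul_log_log_div
    {φs : ℕ → ℝ} (h1 : φs 1 = 1)
    (hm : ∀ m n : ℕ, Nat.Coprime m n → φs (m * n) = φs m * φs n)
    (hpp : ∀ p ν : ℕ, p.Prime → 1 ≤ ν → φs (p ^ ν) = (p : ℝ) ^ ν - 1)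
    {a : ℝ}
    (ha : a < exp (-eulerMascheroniConstant)) :
    ∀ᶠ n : ℕ in atTop, a ≤ φs n * log (log n) / n := by
  have hfloor : Tendsto (fun n : ℕ => ⌊log n⌋₊) atTop atTop :=
    tendsto_nat_floor_atTop.comp (tendsto_log_atTop.comp tendsto_natCast_atTop_atTop)
  have hinv : Tendsto (fun m : ℕ => 1 - 2 * (log m)⁻¹) atTop (𝓝 (1 - 2 * 0)) :=
    ((tendsto_inv_atTop_zero.comp
      (tendsto_log_atTop.comp tendsto_natCast_atTop_atTop)).const_mul 2).const_sub 1
  have h := tendsto_prod_primesBelow_mul_log.mul hinv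
  rw [mul_zero, sub_zero, mul_one] at h
  filter_upwards [hfloor.eventually (h.eventually_const_lt ha), hfloor.eventually_ge_atTop 2,
    eventually_ne_atTop 0] with n hlt h2 hn
  have hn' : (0 : ℝ) < n := by exact_mod_cast Nat.pos_of_ne_zero hn
  have hll : 0 ≤ log (log n) := by
    have : 1 ≤ ⌊log n⌋₊ := by omega
    exact log_nonneg ((Nat.one_le_floor_iff _).1 this)
  refine hlt.le.trans ((prod_primesBelow_mul_le_prod_primeFactors_mul_log_log hn h2).trans ?_)
  rw [le_div_iff₀ hn', mul_right_comm]
  refine mul_le_mul_of_nonneg_right ?_ hll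
  rw [mul_comm]
  exact mul_prod_le_unitary_phi h1 hm hpp hn

theorem frequently_unitary_phi_mul_log_log_div_le
    {φs : ℕ → ℝ} (h1 : φs 1 = 1)
    (hm : ∀ m n : ℕ, Nat.Coprime m n → φs (m * n) = φs m * φs n)
    (hpp : ∀ p ν : ℕ, p.Prime → 1 ≤ ν → φs (p ^ ν) = (p : ℝ) ^ ν - 1)
    {a : ℝ}
    (ha : exp (-eulerMascheroniConstant) < a) :
    ∃ᶠ n : ℕ in atTop, φs n * log (log n) / n ≤ a := by
  have hinv : Tendsto (fun m : ℕ => 1 + log 2 * (log m)⁻¹) atTop (𝓝 (1 + log 2 * 0)) :=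
    ((tendsto_inv_atTop_zero.comp
      (tendsto_log_atTop.comp tendsto_natCast_atTop_atTop)).const_mul (log 2)).const_add 1
  have h := tendsto_prod_primesBelow_mul_log.mul hinv
  rw [mul_zero, add_zero, mul_one] at h
  obtain ⟨N, hN⟩ := eventually_atTop.1 (h.eventually_lt_const ha)
  refine frequently_atTop.2 fun b => ?_
  obtain ⟨q, hq, hqp⟩ := Nat.exists_infinite_primes (max N b)
  have hpos := primorial_pos q
  refine ⟨primorial q, ?_, ?_⟩
  · exact (le_max_right N b).trans (hq.trans (Nat.le_of_dvd hpos hqp.dvd_primorial))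
  · have hpos' : (0 : ℝ) < primorial q := by exact_mod_cast hpos
    have hφ : φs (primorial q) =
        primorial q * ∏ p ∈ Nat.primesBelow (q + 1), (1 - (p : ℝ)⁻¹) :=
      unitary_phi_prod_primes h1 hm hpp fun p hp => (Finset.mem_filter.1 hp).2
    have hP : 0 ≤ ∏ p ∈ Nat.primesBelow (q + 1), (1 - (p : ℝ)⁻¹) :=
      Finset.prod_nonneg fun p hp =>
        (prime_one_sub_inv_mem_Ioo (Nat.prime_of_mem_primesBelow hp)).1.le
    have hlog : 0 < log (q + 1 : ℕ) := log_pos (by exact_mod_cast Nat.succ_lt_succ hqp.pos)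
    refine le_trans ?_ (hN (q + 1) ((le_max_left N b).trans (hq.trans q.le_succ))).le
    rw [hφ, mul_assoc, mul_div_cancel_left₀ _ hpos'.ne', mul_assoc]
    refine mul_le_mul_of_nonneg_left ((log_log_primorial_le hqp.two_le).trans_eq ?_) hP
    field_simp

/-- **Unitary Euler function.** If `φ*` is the multiplicative function with
`φ*(p^ν) = p^ν − 1` for all prime powers, then
`liminf φ*(n) log log n / n = e^{-γ}`. -/
theorem liminf_unitary_phi_eq
    (φs : ℕ → ℝ) (h1 : φs 1 = 1)
    (hm : ∀ m n : ℕ, Nat.Coprime m n → φs (m * n) = φs m * φs n)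
    (hpp : ∀ p ν : ℕ, p.Prime → 1 ≤ ν → φs (p ^ ν) = (p : ℝ) ^ ν - 1) :
    Filter.liminf (fun n : ℕ => φs n * Real.log (Real.log n) / n) Filter.atTop =
      Real.exp (-Real.eulerMascheroniConstant) := by
  refine le_antisymm ?_ ?_
  · have hbdd : IsBoundedUnder (· ≥ ·) atTop fun n : ℕ => φs n * log (log n) / n :=
      isBoundedUnder_of_eventually_ge
        (eventually_le_unitary_phi_mul_log_log_div h1 hm hpp (sub_one_lt _))
    exact le_of_forall_gt_imp_ge_of_dense fun a ha =>
      liminf_le_of_frequently_le (frequently_unitary_phi_mul_log_log_div_le h1 hm hpp ha) hbdd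
  · have hcobdd : IsCoboundedUnder (· ≥ ·) atTop fun n : ℕ => φs n * log (log n) / n :=
      IsCoboundedUnder.of_frequently_le
        (frequently_unitary_phi_mul_log_log_div_le h1 hm hpp (lt_add_one _))
    exact le_of_forall_lt_imp_le_of_dense fun a ha =>
      le_liminf_of_le hcobdd (eventually_le_unitary_phi_mul_log_log_div h1 hm hpp ha)
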